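/- Truth Lemma 1: in the canonical model M, for every moment m ∉ Ξ (i.e., m = 0 or m ∈ W), every history h through m, and every sentence A: M, m/h ⊨ A if and only if A ∈ w, where w is the unique maxiconsistent extension of Σ = {¬p : p ∈ Var} ∪ {SA ↔ A : A a sentence} ∪ {[c]_aA ↔ A : A a sentence, a ∈ Ag}. -/

import Mathlib

set_option maxHeartbeats 1000000

/-! Syntax: countably many variables (indexed by ℕ), Booleans (⊥, →),
    modalities `S` (box), `[c]_a` (cstit) and `I_a` (imag) for agents in `Agent`. -/

inductive Form (Agent : Type) : Type
  | var : ℕ → Form Agent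
  | fls : Form Agent
  | imp : Form Agent → Form Agent → Form Agent
  | box : Form Agent → Form Agent
  | cstit : Agent → Form Agent → Form Agent
  | imag : Agent → Form Agent → Form Agent

namespace Form

variable {Agent : Type}

def neg (A : Form Agent) : Form Agent := A.imp .fls

def conj (A B : Form Agent) : Form Agent := (A.imp B.neg).neg

def fiff (A B : Form Agent) : Form Agent := (A.imp B).conj (B.imp A)

/-- `P`, the dual of `S`. -/
def pos (A : Form Agent) : Form Agent := A.neg.box.neg

/-- The dual of `[c]_a`. -/
def posC (a : Agent) (A : Form Agent) : Form Agent := (Form.cstit a A.neg).neg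

def verum : Form Agent := (Form.fls : Form Agent).neg

end Form

def listConj {Agent : Type} : List (Form Agent) → Form Agent
  | [] => Form.verum
  | A :: l => A.conj (listConj l)

/-- Propositional tautologies: true under every Boolean valuation treating
    variables and modalized formulas as atoms. -/
def Tautology {Agent : Type} (A : Form Agent) : Prop :=
  ∀ v : Form Agent → Prop, ¬ v .fls → (∀ B C : Form Agent, v (B.imp C) ↔ (v B → v C)) → v A

/-- The Hilbert system L: (A0) tautologies, (A1) S is S5, (A2) each [c]_a is S5,
    (A3) SA → [c]_aA, (A4) independence axiom, (A5) imagination-as-action axiom;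
    rules: modus ponens, S-necessitation, replacement of equivalents under I_a. -/
inductive Prov {Agent : Type} : Form Agent → Prop
  | taut {A : Form Agent} : Tautology A → Prov A
  | sK (A B : Form Agent) : Prov ((A.imp B).box.imp (A.box.imp B.box))
  | sT (A : Form Agent) : Prov (A.box.imp A)
  | s5 (A : Form Agent) : Prov (A.pos.imp A.pos.box)
  | cK (a : Agent) (A B : Form Agent) :
      Prov ((Form.cstit a (A.imp B)).imp ((Form.cstit a A).imp (Form.cstit a B)))
  | cT (a : Agent) (A : Form Agent) : Prov ((Form.cstit a A).imp A)
  | c5 (a : Agent) (A : Form Agent) :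
      Prov ((Form.posC a A).imp (Form.cstit a (Form.posC a A)))
  | a3 (a : Agent) (A : Form Agent) : Prov (A.box.imp (Form.cstit a A))
  | a4 (l : List (Agent × Form Agent)) (hne : l ≠ []) (hnd : (l.map Prod.fst).Nodup) :
      Prov ((listConj (l.map fun p => (Form.cstit p.1 p.2).pos)).imp
        (listConj (l.map fun p => Form.cstit p.1 p.2)).pos)
  | a5 (a : Agent) (A : Form Agent) :
      Prov ((Form.imag a A).imp ((Form.cstit a (Form.imag a A)).conj (Form.imag a A).box.neg))
  | mp {A B : Form Agent} : Prov (A.imp B) → Prov A → Prov B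
  | necS {A : Form Agent} : Prov A → Prov A.box
  | reI (a : Agent) {A B : Form Agent} :
      Prov (A.fiff B) → Prov ((Form.imag a A).fiff (Form.imag a B))

/-- A set is L-consistent iff no finite conjunction of its members derives a contradiction. -/
def Consistent {Agent : Type} (Γ : Set (Form Agent)) : Prop :=
  ¬ ∃ l : List (Form Agent), (∀ A ∈ l, A ∈ Γ) ∧ Prov ((listConj l).imp .fls)

/-- L-maxiconsistent: L-consistent and maximal among L-consistent sets. -/
def MaxConsistent {Agent : Type} (w : Set (Form Agent)) : Prop :=
  Consistent w ∧ ∀ Γ : Set (Form Agent), Consistent Γ → w ⊆ Γ → Γ = w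

/-- Σ = {¬p : p ∈ Var} ∪ {SA ↔ A} ∪ {[c]_aA ↔ A}. -/
def SigmaSet (Agent : Type) : Set (Form Agent) :=
  {φ | (∃ n : ℕ, φ = (Form.var n : Form Agent).neg) ∨
       (∃ A : Form Agent, φ = A.box.fiff A) ∨
       (∃ (a : Agent) (A : Form Agent), φ = (Form.cstit a A).fiff A)}

/-! Semantics: imagination models and satisfaction. -/

/-- The raw data of an imagination model (frame conditions separated out below). -/
structure PreModel (Agent : Type) where
  Tree : Type
  le : Tree → Tree → Prop
  Choice : Tree → Agent → Set (Set (Set Tree))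
  N : Agent → Tree → Set Tree → Set (Set (Tree × Set Tree))
  V : ℕ → Set (Tree × Set Tree)

namespace PreModel

variable {Agent : Type} (M : PreModel Agent)

/-- Histories are maximal chains. -/
def IsHist (h : Set M.Tree) : Prop := IsMaxChain M.le h

/-- The set of histories passing through `m`. -/
def Hm (m : M.Tree) : Set (Set M.Tree) := {h | M.IsHist h ∧ m ∈ h}

/-- `Choice^m_a(h)`: the histories lying in the same choice cell as `h` at `m`. -/
def Cell (m : M.Tree) (a : Agent) (h : Set M.Tree) : Set (Set M.Tree) :=
  {h' | ∃ e ∈ M.Choice m a, h ∈ e ∧ h' ∈ e}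

/-- Satisfaction at a moment-history pair. -/
def Sat : Form Agent → M.Tree → Set M.Tree → Prop
  | .var n, m, h => (m, h) ∈ M.V n
  | .fls, _, _ => False
  | .imp A B, m, h => Sat A m h → Sat B m h
  | .box A, m, h => ∀ h' ∈ M.Hm m, Sat A m h'
  | .cstit a A, m, h => ∀ h' ∈ M.Cell m a h, Sat A m h'
  | .imag a A, m, h =>
      (∀ h' ∈ M.Cell m a h,
        {p : M.Tree × Set M.Tree | M.IsHist p.2 ∧ p.1 ∈ p.2 ∧ Sat A p.1 p.2} ∈ M.N a m h') ∧
      (∃ h'' ∈ M.Hm m,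
        {p : M.Tree × Set M.Tree | M.IsHist p.2 ∧ p.1 ∈ p.2 ∧ Sat A p.1 p.2} ∉ M.N a m h'')

end PreModel

/-- An imagination model: the raw data together with all frame conditions. -/
structure IModel (Agent : Type) extends PreModel Agent where
  tree_nonempty : Nonempty Tree
  le_refl : ∀ x, le x x
  le_antisymm : ∀ x y, le x y → le y x → x = y
  le_trans : ∀ x y z, le x y → le y z → le x z
  lower_bound : ∀ m1 m2, ∃ m, le m m1 ∧ le m m2
  past_linear : ∀ m m1 m2, le m1 m → le m2 m → le m1 m2 ∨ le m2 m1
  choice_cells_nonempty : ∀ m a, ∀ e ∈ Choice m a, e.Nonempty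
  choice_cover : ∀ m a, ⋃₀ (Choice m a) = toPreModel.Hm m
  choice_disjoint : ∀ m a, ∀ e ∈ Choice m a, ∀ e' ∈ Choice m a, e ≠ e' → e ∩ e' = ∅
  no_choice_between_undivided : ∀ m a, ∀ e ∈ Choice m a, ∀ h h',
      h ∈ toPreModel.Hm m → h' ∈ toPreModel.Hm m → h ∈ e →
      (∃ m', (le m m' ∧ m ≠ m') ∧ m' ∈ h ∧ m' ∈ h') → h' ∈ e
  independence : ∀ m (f : Agent → Set (Set Tree)), (∀ a, f a ∈ Choice m a) →
      (⋂ a, f a).Nonempty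

/-! The canonical model. -/

section Canonical

variable {Agent : Type}

/-- wRw' iff {A : SA ∈ w} ⊆ w'. -/
def CanR (w w' : Set (Form Agent)) : Prop := ∀ A : Form Agent, A.box ∈ w → A ∈ w'

/-- w ≃_a w' iff {A : [c]_aA ∈ w} ⊆ w'. -/
def CanC (a : Agent) (w w' : Set (Form Agent)) : Prop :=
  ∀ A : Form Agent, Form.cstit a A ∈ w → A ∈ w'

/-- The R-class of a maxiconsistent set. -/
def RCls (w : Set (Form Agent)) : Set (Set (Form Agent)) :=
  {w' | MaxConsistent w' ∧ CanR w w'}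

/-- Ξ: the set of R-equivalence classes. -/
def Xi (Agent : Type) : Set (Set (Set (Form Agent))) :=
  {X | ∃ w, MaxConsistent w ∧ X = RCls w}

/-- E(X,a): the ≃_a-equivalence classes within X. -/
def ECls (X : Set (Set (Form Agent))) (a : Agent) : Set (Set (Set (Form Agent))) :=
  {e | ∃ w ∈ X, e = {w' ∈ X | CanC a w w'}}

/-- Raw canonical points: the fresh root `none`, classes `some (inl X)`, worlds `some (inr w)`. -/
def CPoint (Agent : Type) : Type := Option (Set (Set (Form Agent)) ⊕ Set (Form Agent))

/-- Tree = {0} ∪ Ξ ∪ W. -/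
def CTreeSet (Agent : Type) : Set (CPoint Agent) :=
  {x | x = none ∨ (∃ X ∈ Xi Agent, x = some (Sum.inl X)) ∨
       (∃ w, MaxConsistent w ∧ x = some (Sum.inr w))}

def CTree (Agent : Type) : Type := {x : CPoint Agent // x ∈ CTreeSet Agent}

/-- x ≤ y iff x = y or y ∈ x or x = 0. -/
def CLe (x y : CTree Agent) : Prop :=
  x = y ∨ (∃ X w, x.1 = some (Sum.inl X) ∧ y.1 = some (Sum.inr w) ∧ w ∈ X) ∨ x.1 = none

/-- h_w = {0, X, w}. -/
def CHistX (X : Set (Set (Form Agent))) (w : Set (Form Agent)) : Set (CTree Agent) :=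
  {x | x.1 = none ∨ x.1 = some (Sum.inl X) ∨ x.1 = some (Sum.inr w)}

def IsClsMoment (m : CTree Agent) : Prop := ∃ X, m.1 = some (Sum.inl X)

/-- The canonical choice function: vacuous outside Ξ, induced by E(X,a) at X ∈ Ξ. -/
def CChoice (m : CTree Agent) (a : Agent) : Set (Set (Set (CTree Agent))) :=
  {H | (¬ IsClsMoment m ∧ H = {h | IsMaxChain CLe h ∧ m ∈ h}) ∨
       (∃ X, m.1 = some (Sum.inl X) ∧ ∃ e ∈ ECls X a,
          H = {h | ∃ w ∈ e, h = CHistX X w})}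

/-- Ext(A): {X/h_w : w ∈ X ∈ Ξ, A ∈ w}, augmented by all pairs m/h_w with m ∉ Ξ, m ∈ h_w,
    in case A belongs to the maxiconsistent extension of Σ. -/
def CExt (A : Form Agent) : Set (CTree Agent × Set (CTree Agent)) :=
  {p | ∃ X w, X ∈ Xi Agent ∧ w ∈ X ∧ A ∈ w ∧
        p.1.1 = some (Sum.inl X) ∧ p.2 = CHistX X w} ∪
  {p | (∃ w0, MaxConsistent w0 ∧ SigmaSet Agent ⊆ w0 ∧ A ∈ w0) ∧
        ∃ X w, X ∈ Xi Agent ∧ w ∈ X ∧ p.2 = CHistX X w ∧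
          ¬ IsClsMoment p.1 ∧ p.1 ∈ p.2}

/-- N_a(X/h_w) = {Ext A : I_aA ∈ w}; empty at moments outside Ξ. -/
def CN (a : Agent) (m : CTree Agent) (h : Set (CTree Agent)) :
    Set (Set (CTree Agent × Set (CTree Agent))) :=
  {P | ∃ X w, m.1 = some (Sum.inl X) ∧ X ∈ Xi Agent ∧ w ∈ X ∧ h = CHistX X w ∧
        ∃ A, Form.imag a A ∈ w ∧ P = CExt A}

/-- V(p) = {X/h_w : w ∈ X ∈ Ξ, p ∈ w}. -/
def CV (Agent : Type) (n : ℕ) : Set (CTree Agent × Set (CTree Agent)) :=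
  {p | ∃ X w, X ∈ Xi Agent ∧ w ∈ X ∧ Form.var n ∈ w ∧
        p.1.1 = some (Sum.inl X) ∧ p.2 = CHistX X w}

/-- The canonical model (raw data). -/
def CanModel (Agent : Type) : PreModel Agent where
  Tree := CTree Agent
  le := CLe
  Choice := CChoice
  N := CN
  V := CV Agent

/-- The canonical moment corresponding to a class X ∈ Ξ. -/
def clsMoment {X : Set (Set (Form Agent))} (hX : X ∈ Xi Agent) : CTree Agent :=
  ⟨some (Sum.inl X), Or.inr (Or.inl ⟨X, hX, rfl⟩)⟩

end Canonical

section Aux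
variable {Agent : Type}

theorem val_listConj (v : Form Agent → Prop) (h0 : ¬ v .fls)
    (h1 : ∀ B C : Form Agent, v (B.imp C) ↔ (v B → v C)) (l : List (Form Agent)) :
    v (listConj l) ↔ ∀ A ∈ l, v A := by
  induction l with
  | nil => simp [listConj, Form.verum, Form.neg, h1]
  | cons A l ih =>
    simp only [listConj, Form.conj, Form.neg, h1, ih, List.mem_cons, forall_eq_or_imp]
    tauto

theorem mcs_closed {w : Set (Form Agent)} (hw : MaxConsistent w) (l : List (Form Agent))
    (hl : ∀ A ∈ l, A ∈ w) (B : Form Agent) (hB : Prov ((listConj l).imp B)) : B ∈ w := by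
  classical
  have hc : Consistent (insert B w) := by
    rintro ⟨l', hl', hp⟩
    have : ∀ A ∈ l', A = B ∨ A ∈ w := fun A hA => hl' A hA
    refine hw.1 ⟨l ++ l'.filter (fun A => A ≠ B), ?_, ?_⟩
    · intro A hA
      rw [List.mem_append, List.mem_filter] at hA
      rcases hA with hA | ⟨hA, hne⟩
      · exact hl A hA
      · rcases this A hA with h | h
        · simp [h] at hne
        · exact h
    · refine Prov.mp (Prov.mp (Prov.taut ?_) hB) hp
      intro v h0 h1
      simp only [h1, val_listConj v h0 h1]
      intro ha hb hc
      apply hb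
      intro A hA
      by_cases hAB : A = B
      · rw [hAB]
        exact ha fun C hC => hc C (List.mem_append.2 (Or.inl hC))
      · exact hc A (List.mem_append.2 (Or.inr (List.mem_filter.2 ⟨hA, by simpa using hAB⟩)))
  have := hw.2 _ hc (Set.subset_insert B w)
  rw [← this]
  exact Set.mem_insert B w

theorem mcs_prov {w : Set (Form Agent)} (hw : MaxConsistent w) (B : Form Agent)
    (hB : Prov B) : B ∈ w := by
  refine mcs_closed hw [] (by simp) B (Prov.mp (Prov.taut ?_) hB)
  intro v h0 h1
  simp only [h1]
  tauto

theorem mcs_fls {w : Set (Form Agent)} (hw : MaxConsistent w) : Form.fls ∉ w := by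
  intro h
  refine hw.1 ⟨[Form.fls], by simpa using h, Prov.taut ?_⟩
  intro v h0 h1
  simp [h1, val_listConj v h0 h1]

theorem mcs_neg {w : Set (Form Agent)} (hw : MaxConsistent w) (A : Form Agent)
    (hA : A ∉ w) : A.imp .fls ∈ w := by
  classical
  have hc : ¬ Consistent (insert A w) := by
    intro hc
    apply hA
    rw [← hw.2 _ hc (Set.subset_insert A w)]
    exact Set.mem_insert A w
  unfold Consistent at hc
  rw [not_not] at hc
  obtain ⟨l, hl, hp⟩ := hc
  have hl' : ∀ B ∈ l, B = A ∨ B ∈ w := fun B hB => hl B hB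
  refine mcs_closed hw (l.filter (fun B => B ≠ A)) ?_ _ (Prov.mp (Prov.taut ?_) hp)
  · intro B hB
    rw [List.mem_filter] at hB
    rcases hl' B hB.1 with h | h
    · simp [h] at hB
    · exact h
  · intro v h0 h1
    simp only [h1, val_listConj v h0 h1]
    intro ha hb hc
    apply ha
    intro B hB
    by_cases hAB : B = A
    · rw [hAB]; exact hc
    · exact hb B (List.mem_filter.2 ⟨hB, by simpa using hAB⟩)

theorem mcs_imp {w : Set (Form Agent)} (hw : MaxConsistent w) (A B : Form Agent) :
    A.imp B ∈ w ↔ (A ∈ w → B ∈ w) := by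
  constructor
  · intro h hA
    refine mcs_closed hw [A.imp B, A] (by simp [h, hA]) B (Prov.taut ?_)
    intro v h0 h1
    simp only [h1, val_listConj v h0 h1]
    simp [h1]
  · intro h
    by_cases hA : A ∈ w
    · refine mcs_closed hw [B] (by simp [h hA]) _ (Prov.taut ?_)
      intro v h0 h1
      simp only [h1, val_listConj v h0 h1]
      simp
      tauto
    · refine mcs_closed hw [A.imp .fls] (by simp [mcs_neg hw A hA]) _ (Prov.taut ?_)
      intro v h0 h1
      simp only [h1, val_listConj v h0 h1]
      simp [h1]
      tauto

theorem mcs_fiff {w : Set (Form Agent)} (hw : MaxConsistent w) (A B : Form Agent)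
    (h : A.fiff B ∈ w) : A ∈ w ↔ B ∈ w := by
  have h0 := mcs_fls hw
  simp only [Form.fiff, Form.conj, Form.neg, mcs_imp hw] at h
  tauto

theorem cell_eq (m : CTree Agent) (hm : ¬ IsClsMoment m) (h : Set (CTree Agent))
    (hh : h ∈ (CanModel Agent).Hm m) (a : Agent) :
    (CanModel Agent).Cell m a h = (CanModel Agent).Hm m := by
  ext h'
  constructor
  · rintro ⟨e, he, h1, h2⟩
    rcases he with ⟨_, rfl⟩ | ⟨X, hX, _⟩
    · exact h2
    · exact absurd ⟨X, hX⟩ hm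
  · intro h'm
    exact ⟨(CanModel Agent).Hm m, Or.inl ⟨hm, rfl⟩, hh, h'm⟩

end Aux

/-- Truth Lemma 1: for a moment m ∉ Ξ of the canonical model, a history h
    through m, and any sentence A: M, m/h ⊨ A iff A belongs to the (unique) maxiconsistent
    extension w of Σ. -/
theorem truth_lemma_one (Agent : Type) [Fintype Agent] (m : CTree Agent)
    (hm : ¬ IsClsMoment m) (h : Set (CTree Agent)) (hh : h ∈ (CanModel Agent).Hm m)
    (w : Set (Form Agent)) (hw : MaxConsistent w) (hSig : SigmaSet Agent ⊆ w)
    (A : Form Agent) :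
    (CanModel Agent).Sat A m h ↔ A ∈ w := by
  have h0 := mcs_fls hw
  have hbox : ∀ A : Form Agent, A.box ∈ w ↔ A ∈ w := fun A =>
    mcs_fiff hw _ _ (hSig (Or.inr (Or.inl ⟨A, rfl⟩)))
  have hcst : ∀ (a : Agent) (A : Form Agent), Form.cstit a A ∈ w ↔ A ∈ w := fun a A =>
    mcs_fiff hw _ _ (hSig (Or.inr (Or.inr ⟨a, A, rfl⟩)))
  induction A generalizing h with
  | var n =>
    constructor
    · rintro ⟨X, _, _, _, _, hX, _⟩
      exact absurd ⟨X, hX⟩ hm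
    · intro hn
      have : (Form.var n : Form Agent).neg ∈ w := hSig (Or.inl ⟨n, rfl⟩)
      exact absurd ((mcs_imp hw _ _).1 this hn) h0
  | fls => exact ⟨fun x => False.elim x, fun x => absurd x h0⟩
  | imp A B ihA ihB =>
    exact Iff.trans (imp_congr (ihA h hh) (ihB h hh)) (mcs_imp hw A B).symm
  | box A ih =>
    rw [hbox]
    exact ⟨fun x => (ih h hh).1 (x h hh), fun x h' hh' => (ih h' hh').2 x⟩
  | cstit a A ih =>
    rw [hcst]
    have hc := cell_eq m hm h hh a
    constructor
    · intro x
      exact (ih h hh).1 (x h (hc ▸ hh))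
    · intro x h' hh'
      exact (ih h' (hc ▸ hh')).2 x
  | imag a A ih =>
    have hc := cell_eq m hm h hh a
    constructor
    · rintro ⟨x, _⟩
      obtain ⟨X, _, hX, _⟩ := x h (hc ▸ hh)
      exact absurd ⟨X, hX⟩ hm
    · intro x
      have h5 := mcs_prov hw _ (Prov.a5 a A)
      have hb := hbox (Form.imag a A)
      simp only [Form.conj, Form.neg, mcs_imp hw] at h5
      tauto
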